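/- The algebra U_q(sl2) is isomorphic to the equitable algebra U': there is an isomorphism of 𝕂(q)-algebras θ: U' → U_q(sl2) satisfying θ(X^{±1}) = K^{±1}, θ(Y) = K^{-1} + F(q - q^{-1}), θ(Z) = K^{-1} - K^{-1}Eq(q - q^{-1}), and its inverse satisfies θ^{-1}(E) = (1 - XZ)q^{-1}(q - q^{-1})^{-1}, θ^{-1}(F) = (Y - X^{-1})(q - q^{-1})^{-1}, θ^{-1}(K^{±1}) = X^{±1}. -/

import Mathlib

open FreeAlgebra
open scoped TensorProduct

noncomputable section

/-- The field `𝕂(q)` of rational functions in the indeterminate `q` over `𝕂`. -/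
abbrev Kq (K : Type) [Field K] : Type := RatFunc K

/-- The indeterminate `q` viewed as an element of `𝕂(q)`. -/
def qv (K : Type) [Field K] : Kq K := RatFunc.X

/-- Generators `E, F, K, K⁻¹` for the Chevalley presentation of `U_q(sl₂)`. -/
inductive SGen : Type | E | F | K | Kinv

/-- Generators `X, X⁻¹, Y, Z` for the equitable presentation. -/
inductive TGen : Type | X | Xinv | Y | Z

/-- The defining relations of `U_q(sl₂)` in the Chevalley presentation. -/
inductive SRel (K : Type) [Field K] :
    FreeAlgebra (Kq K) SGen → FreeAlgebra (Kq K) SGen → Prop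
  | r1a : SRel K (ι (Kq K) SGen.K * ι (Kq K) SGen.Kinv) 1
  | r1b : SRel K (ι (Kq K) SGen.Kinv * ι (Kq K) SGen.K) 1
  | r2 : SRel K (ι (Kq K) SGen.K * ι (Kq K) SGen.E * ι (Kq K) SGen.Kinv)
      ((qv K ^ 2) • ι (Kq K) SGen.E)
  | r3 : SRel K (ι (Kq K) SGen.K * ι (Kq K) SGen.F * ι (Kq K) SGen.Kinv)
      ((qv K ^ (-2 : ℤ)) • ι (Kq K) SGen.F)
  | r4 : SRel K (ι (Kq K) SGen.E * ι (Kq K) SGen.F - ι (Kq K) SGen.F * ι (Kq K) SGen.E)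
      ((qv K - (qv K)⁻¹)⁻¹ • (ι (Kq K) SGen.K - ι (Kq K) SGen.Kinv))

/-- The defining relations of the equitable presentation. -/
inductive TRel (K : Type) [Field K] :
    FreeAlgebra (Kq K) TGen → FreeAlgebra (Kq K) TGen → Prop
  | e1a : TRel K (ι (Kq K) TGen.X * ι (Kq K) TGen.Xinv) 1
  | e1b : TRel K (ι (Kq K) TGen.Xinv * ι (Kq K) TGen.X) 1
  | e2 : TRel K ((qv K - (qv K)⁻¹)⁻¹ •
      (qv K • (ι (Kq K) TGen.X * ι (Kq K) TGen.Y) -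
        (qv K)⁻¹ • (ι (Kq K) TGen.Y * ι (Kq K) TGen.X))) 1
  | e3 : TRel K ((qv K - (qv K)⁻¹)⁻¹ •
      (qv K • (ι (Kq K) TGen.Y * ι (Kq K) TGen.Z) -
        (qv K)⁻¹ • (ι (Kq K) TGen.Z * ι (Kq K) TGen.Y))) 1
  | e4 : TRel K ((qv K - (qv K)⁻¹)⁻¹ •
      (qv K • (ι (Kq K) TGen.Z * ι (Kq K) TGen.X) -
        (qv K)⁻¹ • (ι (Kq K) TGen.X * ι (Kq K) TGen.Z))) 1

/-- `U_q(sl₂)` with the Chevalley presentation. -/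
abbrev Usl2 (K : Type) [Field K] := RingQuot (SRel K)

/-- The algebra `U'` with the equitable presentation. -/
abbrev Ueq2 (K : Type) [Field K] := RingQuot (TRel K)

def genE (K : Type) [Field K] : Usl2 K := RingQuot.mkAlgHom (Kq K) (SRel K) (ι (Kq K) SGen.E)
def genF (K : Type) [Field K] : Usl2 K := RingQuot.mkAlgHom (Kq K) (SRel K) (ι (Kq K) SGen.F)
def genK (K : Type) [Field K] : Usl2 K := RingQuot.mkAlgHom (Kq K) (SRel K) (ι (Kq K) SGen.K)
def genKinv (K : Type) [Field K] : Usl2 K := RingQuot.mkAlgHom (Kq K) (SRel K) (ι (Kq K) SGen.Kinv)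

def genX (K : Type) [Field K] : Ueq2 K := RingQuot.mkAlgHom (Kq K) (TRel K) (ι (Kq K) TGen.X)
def genXinv (K : Type) [Field K] : Ueq2 K := RingQuot.mkAlgHom (Kq K) (TRel K) (ι (Kq K) TGen.Xinv)
def genY (K : Type) [Field K] : Ueq2 K := RingQuot.mkAlgHom (Kq K) (TRel K) (ι (Kq K) TGen.Y)
def genZ (K : Type) [Field K] : Ueq2 K := RingQuot.mkAlgHom (Kq K) (TRel K) (ι (Kq K) TGen.Z)

end

section Relations

variable {k A : Type*} [Field k] [Ring A] [Algebra k A] {q c : k}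

lemma mul_left_cancel_of_inverse {x y : A} (h : x * y = 1) (a : A) : x * (y * a) = a := by
  rw [← mul_assoc, h, one_mul]

lemma mul_inverse_of_conj {t : k} {x xi a : A} (hx' : xi * x = 1)
    (h : x * a * xi = t • a) : a * xi = t • (xi * a) := by
  have := congrArg (xi * ·) h
  simpa [mul_assoc, mul_left_cancel_of_inverse hx'] using this

lemma mul_of_conj {t : k} (ht : t ≠ 0) {x xi a : A} (hx' : xi * x = 1)
    (h : x * a * xi = t • a) : a * x = t⁻¹ • (x * a) := by
  have := congrArg (· * x) h
  simp only [mul_assoc, hx', mul_one, smul_mul_assoc] at this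
  rw [this, smul_smul, inv_mul_cancel₀ ht, one_smul]

variable (hq : q ≠ 0) (hc : c ≠ 0) (hcq : c = q - q⁻¹)
include hq hc hcq

lemma chevalley_equitable_XY {f x xi : A} (hx : x * xi = 1) (hx' : xi * x = 1)
    (hf : x * f * xi = q ^ (-2 : ℤ) • f) :
    c⁻¹ • (q • (x * (xi + c • f)) - q⁻¹ • ((xi + c • f) * x)) = 1 := by
  have h := mul_of_conj (zpow_ne_zero _ hq) hx' hf
  simp only [mul_add, add_mul, mul_smul_comm, smul_mul_assoc, hx, hx', h]
  match_scalars
  · field_simp; rw [hcq]; field_simp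
  · field_simp; simp

lemma chevalley_equitable_ZX {e x xi : A} (hx : x * xi = 1) (hx' : xi * x = 1)
    (he : x * e * xi = q ^ 2 • e) :
    c⁻¹ • (q • ((xi - (q * c) • (xi * e)) * x) - q⁻¹ • (x * (xi - (q * c) • (xi * e)))) = 1 := by
  have h := mul_of_conj (pow_ne_zero 2 hq) hx' he
  simp only [mul_sub, sub_mul, mul_smul_comm, smul_mul_assoc, mul_assoc, hx, hx', h,
    mul_left_cancel_of_inverse hx, mul_left_cancel_of_inverse hx']
  match_scalars
  · field_simp; rw [hcq]; field_simp
  · field_simp; simp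

lemma chevalley_equitable_YZ {e f x xi : A} (hx' : xi * x = 1)
    (he : x * e * xi = q ^ 2 • e) (hf : x * f * xi = q ^ (-2 : ℤ) • f)
    (hef : e * f - f * e = c⁻¹ • (x - xi)) :
    c⁻¹ • (q • ((xi + c • f) * (xi - (q * c) • (xi * e))) -
      q⁻¹ • ((xi - (q * c) • (xi * e)) * (xi + c • f))) = 1 := by
  have h1 := mul_inverse_of_conj hx' he
  have h2 := mul_inverse_of_conj hx' hf
  have h2' (a : A) : f * (xi * a) = q ^ (-2 : ℤ) • (xi * (f * a)) := by
    rw [← mul_assoc, h2, smul_mul_assoc, mul_assoc]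
  rw [sub_eq_iff_eq_add] at hef
  simp only [mul_sub, sub_mul, mul_add, add_mul, mul_smul_comm, smul_mul_assoc, mul_assoc, hx',
    h1, h2, h2', hef]
  match_scalars
  all_goals field_simp
  all_goals try (rw [hcq]; field_simp)
  all_goals try ring

omit hcq in
lemma mul_swap_of_q_weyl {a b : A} (h : c⁻¹ • (q • (a * b) - q⁻¹ • (b * a)) = 1) :
    b * a = q ^ 2 • (a * b) - (q * c) • 1 := by
  rw [← h]
  match_scalars <;> field_simp
  ring

lemma equitable_chevalley_KE {x xi z : A} (hx : x * xi = 1)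
    (hzx : c⁻¹ • (q • (z * x) - q⁻¹ • (x * z)) = 1) :
    x * ((q⁻¹ * c⁻¹) • (1 - x * z)) * xi = q ^ 2 • ((q⁻¹ * c⁻¹) • (1 - x * z)) := by
  have h := mul_swap_of_q_weyl hq hc hzx
  simp only [h, mul_sub, sub_mul, mul_smul_comm, smul_mul_assoc, mul_one]
  simp only [← mul_assoc, h]
  simp only [sub_mul, smul_mul_assoc, one_mul, mul_assoc, hx, mul_one]
  match_scalars
  all_goals field_simp
  all_goals rw [hcq]; field_simp; try ring

lemma equitable_chevalley_KF {x xi y : A} (hx : x * xi = 1)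
    (hxy : c⁻¹ • (q • (x * y) - q⁻¹ • (y * x)) = 1) :
    x * (c⁻¹ • (y - xi)) * xi = q ^ (-2 : ℤ) • (c⁻¹ • (y - xi)) := by
  have h := mul_swap_of_q_weyl hq hc hxy
  have h' : x * y = q ^ (-2 : ℤ) • (y * x) + (q⁻¹ * c) • 1 := by
    rw [h]
    match_scalars
    · field_simp
    · field_simp; simp
  simp only [mul_sub, sub_mul, mul_smul_comm, smul_mul_assoc, hx, h', add_mul, one_mul]
  simp only [mul_assoc, hx, mul_one]
  match_scalars
  all_goals field_simp
  all_goals rw [hcq]; field_simp; try ring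

lemma equitable_chevalley_EF {x xi y z : A} (hx : x * xi = 1) (hx' : xi * x = 1)
    (hxy : c⁻¹ • (q • (x * y) - q⁻¹ • (y * x)) = 1)
    (hyz : c⁻¹ • (q • (y * z) - q⁻¹ • (z * y)) = 1)
    (hzx : c⁻¹ • (q • (z * x) - q⁻¹ • (x * z)) = 1) :
    (q⁻¹ * c⁻¹) • (1 - x * z) * (c⁻¹ • (y - xi)) -
      c⁻¹ • (y - xi) * ((q⁻¹ * c⁻¹) • (1 - x * z)) = c⁻¹ • (x - xi) := by
  have hyx := mul_swap_of_q_weyl hq hc hxy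
  have hzy := mul_swap_of_q_weyl hq hc hyz
  have hxz := mul_swap_of_q_weyl hq hc hzx
  have hyx' : y * (x * z) = q ^ 2 • (x * (y * z)) - (q * c) • z := by
    rw [← mul_assoc, hyx]
    simp only [sub_mul, smul_mul_assoc, one_mul, mul_assoc]
  have hxzxi : x * (z * xi) = q ^ 2 • z - (q * c) • xi := by
    rw [← mul_assoc, hxz]
    simp only [sub_mul, smul_mul_assoc, one_mul, mul_assoc, hx, mul_one]
  simp only [mul_sub, sub_mul, mul_smul_comm, smul_mul_assoc, one_mul, mul_one, mul_assoc, hzy,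
    hyx', hxzxi, mul_left_cancel_of_inverse hx']
  match_scalars
  all_goals field_simp
  all_goals try (rw [hcq]; field_simp)
  all_goals try ring

end Relations

section Isomorphism

variable (K : Type) [Field K]

lemma qv_ne_zero : qv K ≠ 0 := RatFunc.X_ne_zero

lemma qv_sub_inv_ne_zero : qv K - (qv K)⁻¹ ≠ 0 := by
  intro h
  have hsq : (RatFunc.X : RatFunc K) ^ 2 = 1 := by
    have := mul_inv_cancel₀ (qv_ne_zero K)
    rw [← sub_eq_zero.mp h] at this
    rw [sq]
    exact this
  have hpoly : (Polynomial.X : Polynomial K) ^ 2 = 1 := by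
    apply RatFunc.algebraMap_injective K
    simpa using hsq
  simpa using congrArg Polynomial.natDegree hpoly

lemma genK_mul_genKinv : genK K * genKinv K = 1 := by
  simpa [genK, genKinv] using RingQuot.mkAlgHom_rel (Kq K) (SRel.r1a (K := K))

lemma genKinv_mul_genK : genKinv K * genK K = 1 := by
  simpa [genK, genKinv] using RingQuot.mkAlgHom_rel (Kq K) (SRel.r1b (K := K))

lemma genK_conj_genE : genK K * genE K * genKinv K = qv K ^ 2 • genE K := by
  simpa only [genE, genK, genKinv, map_mul, map_smul]
    using RingQuot.mkAlgHom_rel (Kq K) (SRel.r2 (K := K))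

lemma genK_conj_genF : genK K * genF K * genKinv K = qv K ^ (-2 : ℤ) • genF K := by
  simpa only [genF, genK, genKinv, map_mul, map_smul]
    using RingQuot.mkAlgHom_rel (Kq K) (SRel.r3 (K := K))

lemma genE_genF_commutator : genE K * genF K - genF K * genE K =
    (qv K - (qv K)⁻¹)⁻¹ • (genK K - genKinv K) := by
  simpa only [genE, genF, genK, genKinv, map_mul, map_smul, map_sub]
    using RingQuot.mkAlgHom_rel (Kq K) (SRel.r4 (K := K))

lemma genX_mul_genXinv : genX K * genXinv K = 1 := by
  simpa [genX, genXinv] using RingQuot.mkAlgHom_rel (Kq K) (TRel.e1a (K := K))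

lemma genXinv_mul_genX : genXinv K * genX K = 1 := by
  simpa [genX, genXinv] using RingQuot.mkAlgHom_rel (Kq K) (TRel.e1b (K := K))

lemma genX_genY_relation : (qv K - (qv K)⁻¹)⁻¹ •
    (qv K • (genX K * genY K) - (qv K)⁻¹ • (genY K * genX K)) = 1 := by
  simpa only [genX, genY, map_mul, map_smul, map_sub, map_one]
    using RingQuot.mkAlgHom_rel (Kq K) (TRel.e2 (K := K))

lemma genY_genZ_relation : (qv K - (qv K)⁻¹)⁻¹ •
    (qv K • (genY K * genZ K) - (qv K)⁻¹ • (genZ K * genY K)) = 1 := by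
  simpa only [genY, genZ, map_mul, map_smul, map_sub, map_one]
    using RingQuot.mkAlgHom_rel (Kq K) (TRel.e3 (K := K))

lemma genZ_genX_relation : (qv K - (qv K)⁻¹)⁻¹ •
    (qv K • (genZ K * genX K) - (qv K)⁻¹ • (genX K * genZ K)) = 1 := by
  simpa only [genX, genZ, map_mul, map_smul, map_sub, map_one]
    using RingQuot.mkAlgHom_rel (Kq K) (TRel.e4 (K := K))

/-- The images in `U_q(sl₂)` of the equitable generators. -/
noncomputable def equitableImage : TGen → Usl2 K
  | .X => genK K
  | .Xinv => genKinv K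
  | .Y => genKinv K + (qv K - (qv K)⁻¹) • genF K
  | .Z => genKinv K - (qv K * (qv K - (qv K)⁻¹)) • (genKinv K * genE K)

/-- The images in `U'` of the Chevalley generators. -/
noncomputable def chevalleyImage : SGen → Ueq2 K
  | .E => ((qv K)⁻¹ * (qv K - (qv K)⁻¹)⁻¹) • (1 - genX K * genZ K)
  | .F => (qv K - (qv K)⁻¹)⁻¹ • (genY K - genXinv K)
  | .K => genX K
  | .Kinv => genXinv K

/-- The homomorphism `U' → U_q(sl₂)` given by `equitableImage` on generators. -/
noncomputable def equitableToChevalley : Ueq2 K →ₐ[Kq K] Usl2 K :=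
  RingQuot.liftAlgHom (Kq K) ⟨FreeAlgebra.lift (Kq K) (equitableImage K), by
    intro a b h
    have hq := qv_ne_zero K
    have hc := qv_sub_inv_ne_zero K
    have hx := genK_mul_genKinv K
    have hx' := genKinv_mul_genK K
    cases h <;> simp only [map_mul, map_smul, map_sub, map_one, lift_ι_apply, equitableImage]
    · exact hx
    · exact hx'
    · exact chevalley_equitable_XY hq hc rfl hx hx' (genK_conj_genF K)
    · exact chevalley_equitable_YZ hq hc rfl hx' (genK_conj_genE K) (genK_conj_genF K)
        (genE_genF_commutator K)
    · exact chevalley_equitable_ZX hq hc rfl hx hx' (genK_conj_genE K)⟩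

/-- The homomorphism `U_q(sl₂) → U'` given by `chevalleyImage` on generators. -/
noncomputable def chevalleyToEquitable : Usl2 K →ₐ[Kq K] Ueq2 K :=
  RingQuot.liftAlgHom (Kq K) ⟨FreeAlgebra.lift (Kq K) (chevalleyImage K), by
    intro a b h
    have hq := qv_ne_zero K
    have hc := qv_sub_inv_ne_zero K
    have hx := genX_mul_genXinv K
    have hx' := genXinv_mul_genX K
    cases h <;> simp only [map_mul, map_smul, map_sub, map_one, lift_ι_apply, chevalleyImage]
    · exact hx
    · exact hx'
    · exact equitable_chevalley_KE hq hc rfl hx (genZ_genX_relation K)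
    · exact equitable_chevalley_KF hq hc rfl hx (genX_genY_relation K)
    · exact equitable_chevalley_EF hq hc rfl hx hx' (genX_genY_relation K)
        (genY_genZ_relation K) (genZ_genX_relation K)⟩

lemma equitableToChevalley_mk (g : TGen) :
    equitableToChevalley K (RingQuot.mkAlgHom (Kq K) (TRel K) (ι (Kq K) g)) =
      equitableImage K g := by
  rw [equitableToChevalley, RingQuot.liftAlgHom_mkAlgHom_apply, lift_ι_apply]

lemma chevalleyToEquitable_mk (g : SGen) :
    chevalleyToEquitable K (RingQuot.mkAlgHom (Kq K) (SRel K) (ι (Kq K) g)) =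
      chevalleyImage K g := by
  rw [chevalleyToEquitable, RingQuot.liftAlgHom_mkAlgHom_apply, lift_ι_apply]

lemma equitableToChevalley_comp_chevalleyToEquitable :
    (equitableToChevalley K).comp (chevalleyToEquitable K) = AlgHom.id (Kq K) (Usl2 K) := by
  have hX : equitableToChevalley K (genX K) = genK K := equitableToChevalley_mk K .X
  have hXi : equitableToChevalley K (genXinv K) = genKinv K := equitableToChevalley_mk K .Xinv
  have hY : equitableToChevalley K (genY K) = _ := equitableToChevalley_mk K .Y
  have hZ : equitableToChevalley K (genZ K) = _ := equitableToChevalley_mk K .Z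
  have hq := qv_ne_zero K
  have hc := qv_sub_inv_ne_zero K
  ext g
  simp only [Function.comp_apply, AlgHom.coe_comp, AlgHom.id_comp,
    chevalleyToEquitable_mk]
  cases g <;> simp only [chevalleyImage, map_smul, map_sub, map_mul, map_one, hX, hXi, hY, hZ,
    equitableImage]
  · rw [mul_sub, genK_mul_genKinv, mul_smul_comm,
      mul_left_cancel_of_inverse (genK_mul_genKinv K), sub_sub_cancel, smul_smul,
      ← mul_inv, inv_mul_cancel₀ (mul_ne_zero hq hc), one_smul]
    rfl
  · rw [add_sub_cancel_left, inv_smul_smul₀ hc]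
    rfl
  · rfl
  · rfl

lemma chevalleyToEquitable_comp_equitableToChevalley :
    (chevalleyToEquitable K).comp (equitableToChevalley K) = AlgHom.id (Kq K) (Ueq2 K) := by
  have hK : chevalleyToEquitable K (genK K) = genX K := chevalleyToEquitable_mk K .K
  have hKi : chevalleyToEquitable K (genKinv K) = genXinv K := chevalleyToEquitable_mk K .Kinv
  have hE : chevalleyToEquitable K (genE K) = _ := chevalleyToEquitable_mk K .E
  have hF : chevalleyToEquitable K (genF K) = _ := chevalleyToEquitable_mk K .F
  have hq := qv_ne_zero K
  have hc := qv_sub_inv_ne_zero K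
  ext g
  simp only [Function.comp_apply, AlgHom.coe_comp, AlgHom.id_comp,
    equitableToChevalley_mk]
  cases g <;> simp only [equitableImage, map_smul, map_sub, map_add, map_mul, hK, hKi, hE, hF,
    chevalleyImage]
  · rfl
  · rfl
  · rw [smul_inv_smul₀ hc, add_sub_cancel]
    rfl
  · rw [mul_smul_comm, smul_smul, ← mul_inv, mul_inv_cancel₀ (mul_ne_zero hq hc), one_smul,
      mul_sub, mul_one, mul_left_cancel_of_inverse (genXinv_mul_genX K), sub_sub_cancel]
    rfl

end Isomorphism

/-- The equitable algebra `U'` is isomorphic to `U_q(sl₂)` via an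
isomorphism `θ` with `θ(X^{±1}) = K^{±1}`, `θ(Y) = K⁻¹ + F(q - q⁻¹)`,
`θ(Z) = K⁻¹ - K⁻¹Eq(q - q⁻¹)`, whose inverse satisfies
`θ⁻¹(E) = (1 - XZ)q⁻¹(q - q⁻¹)⁻¹`, `θ⁻¹(F) = (Y - X⁻¹)(q - q⁻¹)⁻¹`, `θ⁻¹(K^{±1}) = X^{±1}`. -/
theorem equitable_presentation_sl2 (K : Type) [Field K] :
    ∃ θ : Ueq2 K ≃ₐ[Kq K] Usl2 K,
      θ (genX K) = genK K ∧
      θ (genXinv K) = genKinv K ∧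
      θ (genY K) = genKinv K + (qv K - (qv K)⁻¹) • genF K ∧
      θ (genZ K) = genKinv K - (qv K * (qv K - (qv K)⁻¹)) • (genKinv K * genE K) ∧
      θ.symm (genE K) = ((qv K)⁻¹ * (qv K - (qv K)⁻¹)⁻¹) • (1 - genX K * genZ K) ∧
      θ.symm (genF K) = (qv K - (qv K)⁻¹)⁻¹ • (genY K - genXinv K) ∧
      θ.symm (genK K) = genX K ∧
      θ.symm (genKinv K) = genXinv K := by
  exact ⟨AlgEquiv.ofAlgHom (equitableToChevalley K) (chevalleyToEquitable K)
      (equitableToChevalley_comp_chevalleyToEquitable K)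
      (chevalleyToEquitable_comp_equitableToChevalley K),
    equitableToChevalley_mk K .X, equitableToChevalley_mk K .Xinv,
    equitableToChevalley_mk K .Y, equitableToChevalley_mk K .Z,
    chevalleyToEquitable_mk K .E, chevalleyToEquitable_mk K .F,
    chevalleyToEquitable_mk K .K, chevalleyToEquitable_mk K .Kinv⟩
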